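/- arXiv:2301.12298 — 5 statements merged into one kernel-verified Lean document; each statement's English description precedes it below -/
import Mathlib

section
/- Let X be a compact topological space and let (f_n)_{n∈ℕ} be an independent sequence of continuous real-valued functions on X. Then there exist real numbers a' < b' such that for EVERY pair of disjoint (not necessarily finite) subsets P, M of ℕ, the set ⋂_{n∈P} f_n⁻¹((−∞, a')) ∩ ⋂_{n∈M} f_n⁻¹((b', ∞)) is nonempty. -/
/-- If `(f n)` is an independent sequence of continuous real functions on a
compact space `X`, then there exist `a' < b'` such that for *every* pair of disjoint
(possibly infinite) subsets `P, M ⊆ ℕ` the corresponding intersection is nonempty. -/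
theorem stmt0 {X : Type*} [TopologicalSpace X] [CompactSpace X]
    (f : ℕ → X → ℝ) (hf : ∀ n, Continuous (f n))
    (hind : ∃ a b : ℝ, a < b ∧ ∀ P M : Finset ℕ, Disjoint P M →
      ∃ x : X, (∀ n ∈ P, f n x < a) ∧ (∀ n ∈ M, b < f n x)) :
    ∃ a' b' : ℝ, a' < b' ∧ ∀ P M : Set ℕ, Disjoint P M →
      ((⋂ n ∈ P, (f n) ⁻¹' Set.Iio a') ∩ ⋂ n ∈ M, (f n) ⁻¹' Set.Ioi b').Nonempty := by
  classical
  obtain ⟨a, b, hab, h⟩ := hind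
  refine ⟨a + (b - a) / 3, b - (b - a) / 3, by linarith, fun P M hPM => ?_⟩
  have hclosed : ∀ n, IsClosed {x | (n ∈ P → f n x ≤ a) ∧ (n ∈ M → b ≤ f n x)} := fun n =>
    (isClosed_imp isOpen_const (isClosed_le (hf n) continuous_const)).inter
      (isClosed_imp isOpen_const (isClosed_le continuous_const (hf n)))
  obtain ⟨x, -, hx⟩ := isCompact_univ.inter_iInter_nonempty _ hclosed fun s => by
    have hdisj : Disjoint (s.filter (· ∈ P)) (s.filter (· ∈ M)) :=
      Finset.disjoint_filter.2 fun n _ hP hM => Set.disjoint_left.1 hPM hP hM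
    obtain ⟨x, hxP, hxM⟩ := h _ _ hdisj
    refine ⟨x, Set.mem_univ x, Set.mem_iInter₂.2 fun n hn => ⟨fun hP => ?_, fun hM => ?_⟩⟩
    · exact (hxP n (Finset.mem_filter.2 ⟨hn, hP⟩)).le
    · exact (hxM n (Finset.mem_filter.2 ⟨hn, hM⟩)).le
  rw [Set.mem_iInter] at hx
  refine ⟨x, Set.mem_iInter₂.2 fun n hn => ?_, Set.mem_iInter₂.2 fun n hn => ?_⟩
  · have := (hx n).1 hn
    simp only [Set.mem_preimage, Set.mem_Iio]
    linarith
  · have := (hx n).2 hn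
    simp only [Set.mem_preimage, Set.mem_Ioi]
    linarith
end

section
/- Let K be a compact topological space and let (f_n)_{n∈ℕ} be a sequence of continuous real-valued functions on K that is independent with bounds of independence a < b. Then there exists a sequence (x_m)_{m∈ℕ} in K such that for every pair of disjoint finite subsets N, M of ℕ there exists n ∈ ℕ with f_n(x_k) ≤ a for all k ∈ N and f_n(x_k) ≥ b for all k ∈ M. In particular, the sequence of evaluation functions (f ↦ f(x_m))_{m∈ℕ} on the set {f_n : n ∈ ℕ} is independent. -/
/-- On a compact space, an independent sequence of continuous functions can be separated weakly
along any subset of the index set, not just along finite ones. -/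
theorem exists_le_and_ge_of_independent {K : Type*} [TopologicalSpace K] [CompactSpace K]
    {f : ℕ → K → ℝ} (hf : ∀ n, Continuous (f n)) {a b : ℝ}
    (hind : ∀ P M : Finset ℕ, Disjoint P M →
      ∃ x : K, (∀ n ∈ P, f n x < a) ∧ (∀ n ∈ M, b < f n x)) (S : Set ℕ) :
    ∃ x : K, (∀ n ∈ S, f n x ≤ a) ∧ (∀ n ∉ S, b ≤ f n x) := by
  classical
  obtain ⟨x, hx⟩ := CompactSpace.iInter_nonempty
    (t := fun n => if n ∈ S then {x | f n x ≤ a} else {x | b ≤ f n x})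
    (fun n => by
      split_ifs
      · exact isClosed_le (hf n) continuous_const
      · exact isClosed_le continuous_const (hf n))
    (fun s => by
      obtain ⟨x, hxa, hxb⟩ := hind (s.filter (· ∈ S)) (s.filter (· ∉ S))
        (Finset.disjoint_filter_filter_not s s _)
      refine ⟨x, Set.mem_iInter₂.2 fun n hn => ?_⟩
      split_ifs with hS
      · exact (hxa n (Finset.mem_filter.2 ⟨hn, hS⟩)).le
      · exact (hxb n (Finset.mem_filter.2 ⟨hn, hS⟩)).le)
  rw [Set.mem_iInter] at hx
  refine ⟨x, fun n hn => ?_, fun n hn => ?_⟩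
  · simpa [hn] using hx n
  · simpa [hn] using hx n


/-- If `(f n)` is an independent sequence of continuous functions on a compact
space `K` with bounds of independence `a < b`, then there is a sequence `(x m)` in `K` such
that for all disjoint finite `N, M ⊆ ℕ` some `f n` satisfies `f n (x k) ≤ a` on `N` and
`f n (x k) ≥ b` on `M`; in particular the evaluation functions `f ↦ f (x m)` form an
independent sequence on `{f n | n ∈ ℕ}`. -/
theorem stmt1 {K : Type*} [TopologicalSpace K] [CompactSpace K]
    (f : ℕ → K → ℝ) (hf : ∀ n, Continuous (f n)) (a b : ℝ) (hab : a < b)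
    (hind : ∀ P M : Finset ℕ, Disjoint P M →
      ∃ x : K, (∀ n ∈ P, f n x < a) ∧ (∀ n ∈ M, b < f n x)) :
    ∃ x : ℕ → K,
      (∀ N M : Finset ℕ, Disjoint N M →
        ∃ n : ℕ, (∀ k ∈ N, f n (x k) ≤ a) ∧ (∀ k ∈ M, b ≤ f n (x k))) ∧
      (∃ a' b' : ℝ, a' < b' ∧ ∀ N M : Finset ℕ, Disjoint N M →
        ∃ n : ℕ, (∀ k ∈ N, f n (x k) < a') ∧ (∀ k ∈ M, b' < f n (x k))) := by
  choose y hya hyb using exists_le_and_ge_of_independent hf hind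
  let e : Finset ℕ ≃ ℕ := Denumerable.eqv (Finset ℕ)
  let x : ℕ → K := fun k => y {n | k ∈ e.symm n}
  have hx : ∀ N M : Finset ℕ, Disjoint N M →
      ∃ n : ℕ, (∀ k ∈ N, f n (x k) ≤ a) ∧ (∀ k ∈ M, b ≤ f n (x k)) := by
    intro N M hNM
    refine ⟨e N, fun k hk => hya _ _ ?_, fun k hk => hyb _ _ ?_⟩
    · simpa using hk
    · simpa using Finset.disjoint_right.1 hNM hk
  refine ⟨x, hx, (2 * a + b) / 3, (a + 2 * b) / 3, by linarith, fun N M hNM => ?_⟩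
  obtain ⟨n, hna, hnb⟩ := hx N M hNM
  exact ⟨n, fun k hk => by linarith [hna k hk], fun k hk => by linarith [hnb k hk]⟩
end

section
/- For m ≥ 1 and n ∈ ℕ define α^(m)_n := ⌊(n mod 2^m)/2^{m−1}⌋ ∈ {0,1}, and set α^(0)_n := 0; let M := {α^(m) : m ∈ ℕ} ⊆ ℓ^∞(ℕ,ℝ). Then there do NOT exist a sequence (a_j)_{j∈ℕ} in ℓ¹(ℕ,ℝ) and real numbers c < d such that for every pair of disjoint finite subsets P, Q of ℕ there is m ∈ ℕ with Σ_n α^(m)_n (a_j)_n < c for all j ∈ P and Σ_n α^(m)_n (a_j)_n > d for all j ∈ Q. In other words, no sequence in ℓ¹, viewed as functions on M via the pairing, is independent (M is co-tame). -/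
/-- `binDigit m n` is the `m`-th binary digit of `n` for `m ≥ 1`
(i.e. `⌊(n mod 2^m)/2^(m-1)⌋`), and `0` for `m = 0`. -/
def binDigit (m n : ℕ) : ℝ :=
  if m = 0 then 0 else ((n % 2 ^ m) / 2 ^ (m - 1) : ℕ)

open Filter Topology

theorem binDigit_nonneg (m n : ℕ) : 0 ≤ binDigit m n := by
  unfold binDigit
  split_ifs
  · exact le_rfl
  · positivity

theorem binDigit_le_one (m n : ℕ) : binDigit m n ≤ 1 := by
  unfold binDigit
  split_ifs with h
  · exact zero_le_one
  · obtain ⟨k, rfl⟩ := Nat.exists_eq_succ_of_ne_zero h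
    have hlt : n % 2 ^ (k + 1) < 2 * 2 ^ k := by
      have := Nat.mod_lt n (pow_pos two_pos (k + 1))
      rwa [pow_succ, mul_comm] at this ⊢
    have : n % 2 ^ (k + 1) / 2 ^ k < 2 := (Nat.div_lt_iff_lt_mul (by positivity)).2 hlt
    have : n % 2 ^ (k + 1) / 2 ^ k ≤ 1 := by omega
    exact_mod_cast this

theorem binDigit_eq_zero_of_lt {m n : ℕ} (h : n < m) : binDigit m n = 0 := by
  unfold binDigit
  split_ifs
  · rfl
  · have : n % 2 ^ m < 2 ^ (m - 1) :=
      (Nat.mod_le _ _).trans_lt ((Nat.le_sub_one_of_lt h).trans_lt Nat.lt_two_pow_self)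
    simp [Nat.div_eq_of_lt this]

/-- The binary digit functions converge to `0` in the weak-star topology. -/
theorem tendsto_tsum_binDigit_mul {a : ℕ → ℝ} (ha : Summable fun n => |a n|) :
    Tendsto (fun m => ∑' n, binDigit m n * a n) atTop (𝓝 0) := by
  have key : Tendsto (fun m => ∑' n, binDigit m n * a n) atTop (𝓝 (∑' _ : ℕ, (0 : ℝ))) := by
    refine tendsto_tsum_of_dominated_convergence ha (fun n => ?_) (.of_forall fun m n => ?_)
    · refine tendsto_const_nhds.congr' ?_
      filter_upwards [eventually_gt_atTop n] with m hm
      rw [binDigit_eq_zero_of_lt hm, zero_mul]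
    · rw [Real.norm_eq_abs, abs_mul, abs_of_nonneg (binDigit_nonneg m n)]
      exact mul_le_of_le_one_left (abs_nonneg _) (binDigit_le_one m n)
  simpa using key

/-- Functions on `ℕ` cannot be independent if one of them exceeds the upper threshold at only
finitely many points. -/
theorem not_independent_of_eventually_le {F : ℕ → ℕ → ℝ} {c d : ℝ} (hcd : c < d)
    (hF : ∀ᶠ m in atTop, F m 0 ≤ d) :
    ¬ ∀ P Q : Finset ℕ, Disjoint P Q →
      ∃ m, (∀ j ∈ P, F m j < c) ∧ ∀ j ∈ Q, d < F m j := by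
  classical
  intro h
  obtain ⟨N, hN⟩ := eventually_atTop.1 hF
  let s := Finset.range N
  obtain ⟨m, hP, hQ⟩ := h ((s.filter fun m => ¬ F m (m + 1) < c).image (· + 1))
    (insert 0 ((s.filter fun m => F m (m + 1) < c).image (· + 1))) (by
      rw [Finset.disjoint_left]
      intro x hx hx'
      simp only [Finset.mem_image, Finset.mem_insert, Finset.mem_filter] at hx hx'
      obtain ⟨m, hm, rfl⟩ := hx
      rcases hx' with h0 | ⟨k, hk, hkm⟩
      · exact Nat.succ_ne_zero m h0
      · obtain rfl : k = m := by omega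
        exact hm.2 hk.2)
  have hmN : m ∈ s := by
    rw [Finset.mem_range]
    by_contra! hm
    exact (hQ 0 (Finset.mem_insert_self _ _)).not_ge (hN m hm)
  by_cases hm : F m (m + 1) < c
  · have := hQ (m + 1) (Finset.mem_insert_of_mem
      (Finset.mem_image_of_mem _ (Finset.mem_filter.2 ⟨hmN, hm⟩)))
    linarith
  · exact hm (hP (m + 1) (Finset.mem_image_of_mem _ (Finset.mem_filter.2 ⟨hmN, hm⟩)))

/-- the countable set `M = {binDigit m : m ∈ ℕ} ⊆ ℓ∞` is co-tame: no sequence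
`(a j)` in `ℓ¹`, viewed as functions on `M` via the pairing `⟨f, α⟩ = ∑ₙ αₙ fₙ`, is
independent. -/
theorem stmt7 :
    ¬ ∃ a : ℕ → ℕ → ℝ, (∀ j, Summable (fun n => |a j n|)) ∧
      ∃ c d : ℝ, c < d ∧ ∀ P Q : Finset ℕ, Disjoint P Q →
        ∃ m : ℕ, (∀ j ∈ P, (∑' n : ℕ, binDigit m n * a j n) < c) ∧
          (∀ j ∈ Q, d < ∑' n : ℕ, binDigit m n * a j n) := by
  rintro ⟨a, ha, c, d, hcd, h⟩
  have hlim := tendsto_tsum_binDigit_mul (ha 0)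
  rcases lt_or_ge 0 d with hd | hd
  · exact not_independent_of_eventually_le (F := fun m j => ∑' n, binDigit m n * a j n) hcd
      (hlim.eventually_le_const hd) h
  · refine not_independent_of_eventually_le (F := fun m j => -∑' n, binDigit m n * a j n)
      (neg_lt_neg hcd) ?_ fun P Q hPQ => ?_
    · filter_upwards [hlim.eventually_const_le (hcd.trans_le hd)] with m hm
      exact neg_le_neg hm
    · obtain ⟨m, hQ, hP⟩ := h Q P hPQ.symm
      exact ⟨m, fun j hj => neg_lt_neg (hP j hj), fun j hj => neg_lt_neg (hQ j hj)⟩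
end

section
/- Consider ℓ¹(ℕ,ℝ) as a commutative Banach algebra under pointwise multiplication, with dual ℓ^∞(ℕ,ℝ). For every φ ∈ ℓ^∞(ℕ,ℝ), the set { (φ_n a_n)_{n∈ℕ} : a ∈ ℓ¹(ℕ,ℝ), ‖a‖₁ ≤ 1 } ⊆ ℓ^∞(ℕ,ℝ) is relatively compact in the weak topology of the Banach space ℓ^∞(ℕ,ℝ). (Every functional on the pointwise-multiplication algebra ℓ¹ is weakly almost periodic.) -/
open scoped ENNReal

/-- A subset of a Banach space is relatively weakly compact if its closure in the weak
topology is compact. -/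
def RelWeaklyCompact {E : Type*} [NormedAddCommGroup E] [NormedSpace ℝ E] (F : Set E) : Prop :=
  IsCompact (closure (toWeakSpace ℝ E '' F))

/-- A bounded operator from a Hilbert space maps closed balls to weakly compact sets. -/
theorem isCompact_toWeakSpace_image_closedBall {H E : Type*} [NormedAddCommGroup H]
    [InnerProductSpace ℝ H] [CompleteSpace H] [NormedAddCommGroup E] [NormedSpace ℝ E]
    (T : H →L[ℝ] E) (r : ℝ) :
    IsCompact (toWeakSpace ℝ E '' (T '' Metric.closedBall 0 r)) := by
  let J := InnerProductSpace.toDual ℝ H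
  let g : WeakDual ℝ H → WeakSpace ℝ E :=
    fun f => toWeakSpace ℝ E (T (J.symm (WeakDual.toStrongDual f)))
  have hg : Continuous g := by
    refine WeakBilin.continuous_of_continuous_eval _ fun u => ?_
    have h : ∀ f : WeakDual ℝ H, u (T (J.symm (WeakDual.toStrongDual f))) =
        f (J.symm (u.comp T)) := by
      intro f
      calc u (T (J.symm (WeakDual.toStrongDual f)))
          = J (J.symm (u.comp T)) (J.symm (WeakDual.toStrongDual f)) := by simp
        _ = J (J.symm (WeakDual.toStrongDual f)) (J.symm (u.comp T)) := by
          simp only [J, InnerProductSpace.toDual_apply_apply, real_inner_comm]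
        _ = f (J.symm (u.comp T)) := by
          rw [LinearIsometryEquiv.apply_symm_apply]; rfl
    exact (WeakDual.eval_continuous (J.symm (u.comp T))).congr fun f => (h f).symm
  convert (WeakDual.isCompact_closedBall (0 : StrongDual ℝ H) r).image hg using 1
  ext y
  constructor
  · rintro ⟨_, ⟨x, hx, rfl⟩, rfl⟩
    refine ⟨StrongDual.toWeakDual (J x), ?_, ?_⟩
    · change J x ∈ Metric.closedBall 0 r
      simpa using hx
    · change toWeakSpace ℝ E (T (J.symm (J x))) = _
      simp
  · rintro ⟨f, hf, rfl⟩
    refine ⟨_, ⟨J.symm (WeakDual.toStrongDual f), ?_, rfl⟩, rfl⟩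
    have hf' : WeakDual.toStrongDual f ∈ Metric.closedBall 0 r := hf
    simpa using hf'

theorem RelWeaklyCompact.of_subset_isCompact {E : Type*} [NormedAddCommGroup E]
    [NormedSpace ℝ E] {F K : Set E} (hK : IsCompact (toWeakSpace ℝ E '' K)) (h : F ⊆ K) :
    RelWeaklyCompact F :=
  hK.closure_of_subset (Set.image_mono h)

/-- Pointwise multiplication by a bounded sequence, as an operator from `ℓ²` to `ℓ∞`. -/
noncomputable def lpMulTwoInfty (φ : lp (fun _ : ℕ => ℝ) ∞) :
    lp (fun _ : ℕ => ℝ) 2 →L[ℝ] lp (fun _ : ℕ => ℝ) ∞ :=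
  have bound (x : lp (fun _ : ℕ => ℝ) 2) (n : ℕ) : ‖φ n * x n‖ ≤ ‖φ‖ * ‖x‖ := by
    rw [norm_mul]
    gcongr
    · exact lp.norm_apply_le_norm ENNReal.top_ne_zero φ n
    · exact lp.norm_apply_le_norm two_ne_zero x n
  LinearMap.mkContinuous
    { toFun := fun x => ⟨fun n => φ n * x n,
        memℓp_infty ⟨‖φ‖ * ‖x‖, by rintro _ ⟨n, rfl⟩; exact bound x n⟩⟩
      map_add' := fun x y => by ext n; exact mul_add _ _ _
      map_smul' := fun c x => by ext n; exact mul_left_comm _ _ _ }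
    ‖φ‖ fun x => lp.norm_le_of_forall_le (by positivity) (bound x)

theorem lpMulTwoInfty_apply (φ : lp (fun _ : ℕ => ℝ) ∞) (x : lp (fun _ : ℕ => ℝ) 2) (n : ℕ) :
    lpMulTwoInfty φ x n = φ n * x n := rfl

theorem lp_one_exists_two (a : lp (fun _ : ℕ => ℝ) 1) (ha : ‖a‖ ≤ 1) :
    ∃ x : lp (fun _ : ℕ => ℝ) 2, ‖x‖ ≤ 1 ∧ ∀ n, x n = a n := by
  refine ⟨⟨a, (lp.memℓp a).of_exponent_ge one_le_two⟩, ?_, fun n => rfl⟩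
  refine lp.norm_le_of_forall_sum_le (by norm_num) zero_le_one fun s => ?_
  have h1 := lp.sum_rpow_le_norm_rpow (p := 1) (by norm_num) a s
  simp only [ENNReal.toReal_one, Real.rpow_one, ENNReal.toReal_ofNat, Real.rpow_ofNat,
    one_pow] at h1 ⊢
  refine le_trans (Finset.sum_le_sum fun n _ => ?_) (h1.trans ha)
  exact pow_le_of_le_one (norm_nonneg _)
    ((lp.norm_apply_le_norm one_ne_zero a n).trans ha) two_ne_zero

/-- in the Banach algebra `ℓ¹` with pointwise multiplication, every
functional `φ ∈ ℓ∞ = (ℓ¹)*` is weakly almost periodic: the set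
`{(φₙ aₙ)ₙ : a ∈ ℓ¹, ‖a‖₁ ≤ 1} ⊆ ℓ∞` is relatively weakly compact in `ℓ∞`. -/
theorem stmt16 (φ : lp (fun _ : ℕ => ℝ) ∞) :
    RelWeaklyCompact {ψ : lp (fun _ : ℕ => ℝ) ∞ |
      ∃ a : lp (fun _ : ℕ => ℝ) 1, ‖a‖ ≤ 1 ∧ ∀ n : ℕ, ψ n = φ n * a n} := by
  refine .of_subset_isCompact (isCompact_toWeakSpace_image_closedBall (lpMulTwoInfty φ) 1) ?_
  rintro ψ ⟨a, ha, hψ⟩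
  obtain ⟨x, hx, hxa⟩ := lp_one_exists_two a ha
  refine ⟨x, by simpa using hx, ?_⟩
  ext n
  rw [lpMulTwoInfty_apply, hψ, hxa]
end

section
/- Let A be the Banach algebra of bounded linear operators from ℓ¹(ℕ,ℝ) to itself with the operator norm, let x ∈ ℓ¹(ℕ,ℝ) with x ≠ 0, and let φ ∈ ℓ^∞(ℕ,ℝ) = (ℓ¹)* with φ ≠ 0. Then there exist a constant c > 0 and sequences (S_n)_{n∈ℕ} and (T_m)_{m∈ℕ} of operators in the closed unit ball of A such that for every pair of disjoint finite subsets P, Q of ℕ there is m ∈ ℕ with φ(S_n(T_m(x))) ≥ c for all n ∈ P and φ(S_n(T_m(x))) = 0 for all n ∈ Q. In particular, the sequence of functions T ↦ φ(S_n(T(x))) on the closed unit ball of A is independent, so the functional Φ_{x,φ}(T) := φ(T(x)) is not a tame functional on A. -/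
open scoped ENNReal

theorem lp_one_norm_eq_tsum (y : lp (fun _ : ℕ => ℝ) 1) : ‖y‖ = ∑' k, |y k| := by
  simpa using lp.norm_eq_tsum_rpow (p := 1) (by simp) y

theorem lp_one_summable_abs (y : lp (fun _ : ℕ => ℝ) 1) : Summable fun k => |y k| := by
  simpa using (lp.memℓp y).summable (by simp)

theorem abs_mul_le_of_abs_le_one {s : ℕ → ℝ} (hs : ∀ k, |s k| ≤ 1)
    (y : lp (fun _ : ℕ => ℝ) 1) (k : ℕ) : |s k * y k| ≤ |y k| := by
  rw [abs_mul]
  exact mul_le_of_le_one_left (abs_nonneg _) (hs k)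

theorem summable_mul_of_abs_le_one {s : ℕ → ℝ} (hs : ∀ k, |s k| ≤ 1)
    (y : lp (fun _ : ℕ => ℝ) 1) : Summable fun k => s k * y k :=
  Summable.of_abs (Summable.of_nonneg_of_le (fun _ => abs_nonneg _)
    (abs_mul_le_of_abs_le_one hs y) (lp_one_summable_abs y))

/-- The rank one operator `y ↦ (∑ k, s k * y k) • e_j` on `ℓ¹`, for `s` bounded by one. -/
noncomputable def rankOneLp (s : ℕ → ℝ) (hs : ∀ k, |s k| ≤ 1) (j : ℕ) :
    lp (fun _ : ℕ => ℝ) 1 →L[ℝ] lp (fun _ : ℕ => ℝ) 1 :=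
  LinearMap.mkContinuous
    { toFun := fun y => (∑' k, s k * y k) • lp.single 1 j (1 : ℝ)
      map_add' := fun y z => by
        rw [← add_smul, ← (summable_mul_of_abs_le_one hs y).tsum_add
          (summable_mul_of_abs_le_one hs z)]
        simp [mul_add]
      map_smul' := fun r y => by
        rw [RingHom.id_apply, smul_smul, ← tsum_mul_left]
        simp [mul_left_comm] }
    1 fun y => by
      have hsum := summable_mul_of_abs_le_one hs y
      have h : |∑' k, s k * y k| ≤ ∑' k, |y k| :=
        (norm_tsum_le_tsum_norm hsum.norm).trans
          (hsum.norm.tsum_le_tsum (abs_mul_le_of_abs_le_one hs y) (lp_one_summable_abs y))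
      simpa [norm_smul, lp.norm_single, lp_one_norm_eq_tsum y] using h

theorem norm_rankOneLp_le (s : ℕ → ℝ) (hs : ∀ k, |s k| ≤ 1) (j : ℕ) :
    ‖rankOneLp s hs j‖ ≤ 1 :=
  LinearMap.mkContinuous_norm_le _ zero_le_one _

theorem rankOneLp_apply (s : ℕ → ℝ) (hs : ∀ k, |s k| ≤ 1) (j : ℕ)
    (y : lp (fun _ : ℕ => ℝ) 1) (k : ℕ) :
    rankOneLp s hs j y k = if k = j then ∑' l, s l * y l else 0 := by
  change ((∑' l, s l * y l) • lp.single 1 j (1 : ℝ) : lp (fun _ : ℕ => ℝ) 1) k = _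
  by_cases h : k = j <;> simp [h, lp.single_apply]

theorem tsum_mul_rankOneLp (f s : ℕ → ℝ) (hs : ∀ k, |s k| ≤ 1) (j : ℕ)
    (y : lp (fun _ : ℕ => ℝ) 1) :
    ∑' k, f k * rankOneLp s hs j y k = f j * ∑' l, s l * y l := by
  simp [rankOneLp_apply]

/-- let `A = L(ℓ¹, ℓ¹)`, `0 ≠ x ∈ ℓ¹`, `0 ≠ φ ∈ ℓ∞ = (ℓ¹)*`. Then there are
`c > 0` and sequences `(Sₙ)`, `(Tₘ)` in the closed unit ball of `A` such that for all
disjoint finite `P, Q ⊆ ℕ` there is `m` with `φ(Sₙ(Tₘ x)) ≥ c` for `n ∈ P` and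
`φ(Sₙ(Tₘ x)) = 0` for `n ∈ Q`; in particular the functions `T ↦ φ(Sₙ(T x))` on the closed
unit ball of `A` form an independent sequence, so `Φ_{x,φ}` is not a tame functional. -/
theorem stmt17 (x : lp (fun _ : ℕ => ℝ) 1) (hx : x ≠ 0)
    (φ : lp (fun _ : ℕ => ℝ) ∞) (hφ : φ ≠ 0) :
    ∃ c > (0 : ℝ),
      ∃ S T : ℕ → (lp (fun _ : ℕ => ℝ) 1 →L[ℝ] lp (fun _ : ℕ => ℝ) 1),
        (∀ n, ‖S n‖ ≤ 1) ∧ (∀ m, ‖T m‖ ≤ 1) ∧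
        (∀ P Q : Finset ℕ, Disjoint P Q → ∃ m : ℕ,
          (∀ n ∈ P, c ≤ ∑' k : ℕ, φ k * (S n (T m x)) k) ∧
          (∀ n ∈ Q, (∑' k : ℕ, φ k * (S n (T m x)) k) = 0)) ∧
        (∃ a b : ℝ, a < b ∧ ∀ P Q : Finset ℕ, Disjoint P Q →
          ∃ U : lp (fun _ : ℕ => ℝ) 1 →L[ℝ] lp (fun _ : ℕ => ℝ) 1, ‖U‖ ≤ 1 ∧
            (∀ n ∈ P, (∑' k : ℕ, φ k * (S n (U x)) k) < a) ∧
            (∀ n ∈ Q, b < ∑' k : ℕ, φ k * (S n (U x)) k)) := by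
  obtain ⟨i, hi⟩ : ∃ i, x i ≠ 0 := by
    by_contra! h
    exact hx (lp.ext (funext h))
  obtain ⟨j, hj⟩ : ∃ j, φ j ≠ 0 := by
    by_contra! h
    exact hφ (lp.ext (funext h))
  have hc : 0 < |φ j * x i| := abs_pos.2 (mul_ne_zero hj hi)
  obtain ⟨σ, hσ, hσc⟩ : ∃ σ : ℝ, |σ| ≤ 1 ∧ φ j * (σ * x i) = |φ j * x i| := by
    rcases abs_choice (φ j * x i) with h | h
    · exact ⟨1, by simp, by rw [h]; ring⟩
    · exact ⟨-1, by simp, by rw [h]; ring⟩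
  let e : Finset ℕ ≃ ℕ := Denumerable.eqv (Finset ℕ)
  let s : ℕ → ℕ → ℝ := fun n k => if n ∈ e.symm k then σ else 0
  have hs : ∀ n k, |s n k| ≤ 1 := fun n k => by
    by_cases h : n ∈ e.symm k <;> simp [s, h, hσ]
  have ht : ∀ k, |(Pi.single i 1 : ℕ → ℝ) k| ≤ 1 := fun k => by
    by_cases h : k = i <;> simp [h]
  let S n := rankOneLp (s n) (hs n) j
  let T m := rankOneLp (Pi.single i 1) ht m
  have key : ∀ n m, ∑' k, φ k * S n (T m x) k =
      if n ∈ e.symm m then |φ j * x i| else 0 := fun n m => by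
    rw [tsum_mul_rankOneLp, tsum_mul_rankOneLp]
    have : ∑' l, (Pi.single i 1 : ℕ → ℝ) l * x l = x i := by
      simp [Pi.single_apply]
    rw [this]
    by_cases h : n ∈ e.symm m <;> simp [s, h, hσc]
  refine ⟨|φ j * x i|, hc, S, T, fun n => norm_rankOneLp_le _ _ _,
    fun m => norm_rankOneLp_le _ _ _, fun P Q hPQ => ⟨e P, fun n hn => ?_, fun n hn => ?_⟩,
    |φ j * x i| / 3, |φ j * x i| / 2, by linarith, fun P Q hPQ => ⟨T (e Q),
      norm_rankOneLp_le _ _ _, fun n hn => ?_, fun n hn => ?_⟩⟩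
  · simp [key, hn]
  · simp [key, Finset.disjoint_right.1 hPQ hn]
  · simpa [key, Finset.disjoint_left.1 hPQ hn] using hc
  · simpa [key, hn] using hc
end
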